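/- Let s ≥ 2, m ≥ 0 and k ≥ s. Then Σ_{j=0}^{s−1} Γ_j^{[s,s+m]×k} = 3·2^{3s−4} − 2^{2s−3}; i.e. the number of pairs (α,β) whose double persymmetric matrix has rank at most s−1 equals 3·2^{3s−4} − 2^{2s−3}. -/

import Mathlib

open Matrix

/-- The `a × k` Hankel (persymmetric) matrix over `F_2` whose `(i,j)` entry is `α (i+j)`. -/
def hankel (a k : ℕ) (α : Fin (a + k - 1) → ZMod 2) :
    Matrix (Fin a) (Fin k) (ZMod 2) :=
  Matrix.of fun i j => α ⟨(i : ℕ) + (j : ℕ), by have := i.isLt; have := j.isLt; omega⟩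

/-- `Γ_i^{[a,b]×k}` : the number of pairs `(α, β)` such that the `(a+b) × k` matrix obtained
by stacking the `a × k` Hankel matrix of `α` on top of the `b × k` Hankel matrix of `β`
has rank `i` over `F_2`. -/
noncomputable def Gamma (a b k i : ℕ) : ℕ :=
  Nat.card {p : (Fin (a + k - 1) → ZMod 2) × (Fin (b + k - 1) → ZMod 2) //
    (Matrix.fromRows (hankel a k p.1) (hankel b k p.2)).rank = i}

section HankelRank

open Polynomial Module

variable {K : Type*} [Field K]

/-- The `a × k` Hankel matrix of an infinite sequence. -/
def seqHankel (a k : ℕ) (f : ℕ → K) : Matrix (Fin a) (Fin k) K :=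
  Matrix.of fun i j => f (i + j)

/-- Two Hankel matrices with the same number of columns, stacked. -/
def seqStack (a b k : ℕ) (f g : ℕ → K) : Matrix (Fin a ⊕ Fin b) (Fin k) K :=
  Matrix.fromRows (seqHankel a k f) (seqHankel b k g)

/-- The functional on `K[X]` sending `X ^ n` to `f n`. -/
noncomputable def momentFunctional (f : ℕ → K) : K[X] →ₗ[K] K :=
  Polynomial.lsum fun n => LinearMap.toSpanSingleton K K (f n)

/-- The polynomial of degree less than `n` with prescribed coefficients. -/
noncomputable def polyOfVec (K : Type*) [Field K] (n : ℕ) : (Fin n → K) →ₗ[K] K[X] :=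
  (degreeLT K n).subtype ∘ₗ (degreeLTEquiv K n).symm.toLinearMap

lemma polyOfVec_injective (n : ℕ) : Function.Injective (polyOfVec K n) :=
  (Submodule.injective_subtype _).comp (degreeLTEquiv K n).symm.injective

lemma polyOfVec_mem (n : ℕ) (v : Fin n → K) : polyOfVec K n v ∈ degreeLT K n :=
  ((degreeLTEquiv K n).symm v).2

lemma polyOfVec_eq_sum (n : ℕ) (v : Fin n → K) :
    polyOfVec K n v = ∑ i : Fin n, monomial i (v i) := rfl

lemma exists_polyOfVec {n : ℕ} {p : K[X]} (hp : p ∈ degreeLT K n) :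
    ∃ v, polyOfVec K n v = p :=
  ⟨degreeLTEquiv K n ⟨p, hp⟩, by simp [polyOfVec]⟩

lemma momentFunctional_X_pow_mul_polyOfVec (f : ℕ → K) (n i : ℕ) (v : Fin n → K) :
    momentFunctional f (X ^ i * polyOfVec K n v) = ∑ l : Fin n, f (i + l) * v l := by
  simp [polyOfVec_eq_sum, momentFunctional, Finset.mul_sum, X_pow_mul_monomial,
    Polynomial.lsum_apply, sum_monomial_index, mul_comm, add_comm]

lemma exists_X_mul_notMem {n : ℕ} {P : Submodule K K[X]} (hP : P ≤ degreeLT K n)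
    {p : K[X]} (hp : p ∈ P) (hp0 : p ≠ 0) : ∃ q ∈ P, X * q ∉ P := by
  by_contra! h
  have hmem : ∀ i : ℕ, X ^ i * p ∈ P := by
    intro i
    induction i with
    | zero => simpa using hp
    | succ i ih =>
      have := h _ ih
      rwa [← mul_assoc, ← pow_succ'] at this
  have h1 := mem_degreeLT.1 (hP (hmem n))
  rw [degree_mul, degree_X_pow, degree_eq_natDegree hp0] at h1
  norm_cast at h1
  omega

lemma X_mul_mem_degreeLT {n : ℕ} {p : K[X]} (hp : p ∈ degreeLT K n) :
    X * p ∈ degreeLT K (n + 1) := by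
  rw [mem_degreeLT] at *
  by_cases h : p = 0
  · simp [h]
  · rw [degree_mul, degree_X, degree_eq_natDegree h] at *
    norm_cast at *
    omega

/-- The right kernel of a stacked Hankel matrix, as a space of polynomials. -/
noncomputable def rightKer (a b k : ℕ) (f g : ℕ → K) : Submodule K K[X] :=
  (LinearMap.ker (seqStack a b k f g).mulVecLin).map (polyOfVec K k)

/-- The left kernel of a stacked Hankel matrix, as a space of pairs of polynomials. -/
noncomputable def leftKer (a b k : ℕ) (f g : ℕ → K) : Submodule K (K[X] × K[X]) :=
  (LinearMap.ker (seqStack a b k f g)ᵀ.mulVecLin).map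
    (((polyOfVec K a).prodMap (polyOfVec K b)) ∘ₗ
      (LinearEquiv.sumArrowLequivProdArrow (Fin a) (Fin b) K K).toLinearMap)

lemma mem_rightKer {a b k : ℕ} {f g : ℕ → K} {p : K[X]} :
    p ∈ rightKer a b k f g ↔ p ∈ degreeLT K k ∧
      (∀ i < a, momentFunctional f (X ^ i * p) = 0) ∧
      (∀ i < b, momentFunctional g (X ^ i * p) = 0) := by
  have key : ∀ v : Fin k → K, seqStack a b k f g *ᵥ v = 0 ↔
      (∀ i < a, momentFunctional f (X ^ i * polyOfVec K k v) = 0) ∧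
      (∀ i < b, momentFunctional g (X ^ i * polyOfVec K k v) = 0) := by
    intro v
    simp only [momentFunctional_X_pow_mul_polyOfVec, funext_iff, Sum.forall, seqStack,
      fromRows_mulVec, Fin.forall_iff]
    rfl
  simp only [rightKer, Submodule.mem_map, LinearMap.mem_ker, Matrix.mulVecLin_apply]
  constructor
  · rintro ⟨v, hv, rfl⟩
    exact ⟨polyOfVec_mem _ _, (key v).1 hv⟩
  · rintro ⟨hp, h⟩
    obtain ⟨v, rfl⟩ := exists_polyOfVec hp
    exact ⟨v, (key v).2 h, rfl⟩

lemma mem_leftKer {a b k : ℕ} {f g : ℕ → K} {p : K[X] × K[X]} :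
    p ∈ leftKer a b k f g ↔ p.1 ∈ degreeLT K a ∧ p.2 ∈ degreeLT K b ∧
      ∀ i < k, momentFunctional f (X ^ i * p.1) + momentFunctional g (X ^ i * p.2) = 0 := by
  have key : ∀ v : Fin a ⊕ Fin b → K, (seqStack a b k f g)ᵀ *ᵥ v = 0 ↔
      ∀ i < k, momentFunctional f (X ^ i * polyOfVec K a (v ∘ Sum.inl)) +
        momentFunctional g (X ^ i * polyOfVec K b (v ∘ Sum.inr)) = 0 := by
    intro v
    simp only [momentFunctional_X_pow_mul_polyOfVec, funext_iff, Fin.forall_iff]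
    simp [Matrix.mulVec, dotProduct, seqStack, seqHankel, add_comm]
  simp only [leftKer, Submodule.mem_map, LinearMap.mem_ker, Matrix.mulVecLin_apply]
  constructor
  · rintro ⟨v, hv, rfl⟩
    exact ⟨polyOfVec_mem _ _, polyOfVec_mem _ _, (key v).1 hv⟩
  · rintro ⟨hp, hq, h⟩
    obtain ⟨u, hu⟩ := exists_polyOfVec hp
    obtain ⟨v, hv⟩ := exists_polyOfVec hq
    refine ⟨Sum.elim u v, (key _).2 ?_, ?_⟩
    · simpa [hu, hv] using h
    · exact Prod.ext hu hv

lemma finrank_ker_mulVecLin_add_rank {m n : Type*} [Fintype m] [Fintype n] (M : Matrix m n K) :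
    finrank K (LinearMap.ker M.mulVecLin) + M.rank = Fintype.card n := by
  rw [add_comm, Matrix.rank, LinearMap.finrank_range_add_finrank_ker, finrank_fintype_fun_eq_card]

lemma finrank_rightKer (a b k : ℕ) (f g : ℕ → K) :
    finrank K (rightKer a b k f g) + (seqStack a b k f g).rank = k := by
  rw [rightKer, ← (Submodule.equivMapOfInjective _ (polyOfVec_injective k) _).finrank_eq,
    finrank_ker_mulVecLin_add_rank, Fintype.card_fin]

lemma finrank_leftKer (a b k : ℕ) (f g : ℕ → K) :
    finrank K (leftKer a b k f g) + (seqStack a b k f g).rank = a + b := by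
  have hinj : Function.Injective (((polyOfVec K a).prodMap (polyOfVec K b)) ∘ₗ
      (LinearEquiv.sumArrowLequivProdArrow (Fin a) (Fin b) K K).toLinearMap) :=
    ((polyOfVec_injective a).prodMap (polyOfVec_injective b)).comp
      (LinearEquiv.sumArrowLequivProdArrow (Fin a) (Fin b) K K).injective
  rw [leftKer, ← (Submodule.equivMapOfInjective _ hinj _).finrank_eq, ← rank_transpose,
    finrank_ker_mulVecLin_add_rank, Fintype.card_sum, Fintype.card_fin, Fintype.card_fin]

instance (a b k : ℕ) (f g : ℕ → K) : FiniteDimensional K (rightKer a b k f g) := by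
  unfold rightKer; infer_instance

instance (a b k : ℕ) (f g : ℕ → K) : FiniteDimensional K (leftKer a b k f g) := by
  unfold leftKer; infer_instance

/-- Trading a row of each block for a column does not increase a rank below the number of
columns. -/
lemma rank_seqStack_succ_le {a b k : ℕ} {f g : ℕ → K}
    (h : (seqStack (a + 1) (b + 1) k f g).rank < k) :
    (seqStack a b (k + 1) f g).rank ≤ (seqStack (a + 1) (b + 1) k f g).rank := by
  have h1 := finrank_rightKer (a + 1) (b + 1) k f g
  have h2 := finrank_rightKer a b (k + 1) f g
  have hne : rightKer (a + 1) (b + 1) k f g ≠ ⊥ := by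
    intro h0
    rw [h0, finrank_bot] at h1
    omega
  obtain ⟨p, hp, hp0⟩ := Submodule.exists_mem_ne_zero_of_ne_bot hne
  obtain ⟨q, hq, hXq⟩ := exists_X_mul_notMem (fun _ h => (mem_rightKer.1 h).1) hp hp0
  have hlt : rightKer (a + 1) (b + 1) k f g < rightKer a b (k + 1) f g := by
    refine lt_of_le_of_ne (fun r hr => ?_) fun he => hXq ?_
    · obtain ⟨hr1, hr2, hr3⟩ := mem_rightKer.1 hr
      exact mem_rightKer.2 ⟨degreeLT_mono (Nat.le_succ k) hr1,
        fun i hi => hr2 i (by omega), fun i hi => hr3 i (by omega)⟩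
    · rw [he]
      obtain ⟨hr1, hr2, hr3⟩ := mem_rightKer.1 hq
      refine mem_rightKer.2 ⟨X_mul_mem_degreeLT hr1, fun i hi => ?_, fun i hi => ?_⟩
      · rw [← mul_assoc, ← pow_succ]
        exact hr2 _ (by omega)
      · rw [← mul_assoc, ← pow_succ]
        exact hr3 _ (by omega)
  have := Submodule.finrank_lt_finrank_of_lt hlt
  omega

lemma exists_leftKer_of_rank_lt {a k : ℕ} {f : ℕ → K} (h : (seqHankel a k f).rank < a) :
    ∃ p ∈ degreeLT K a, p ≠ 0 ∧ ∀ i < k, momentFunctional f (X ^ i * p) = 0 := by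
  have hpos := finrank_ker_mulVecLin_add_rank (seqHankel a k f)ᵀ
  rw [rank_transpose, Fintype.card_fin] at hpos
  have hne : LinearMap.ker (seqHankel a k f)ᵀ.mulVecLin ≠ ⊥ := by
    intro h0
    rw [h0, finrank_bot] at hpos
    omega
  obtain ⟨v, hv, hv0⟩ := Submodule.exists_mem_ne_zero_of_ne_bot hne
  refine ⟨polyOfVec K a v, polyOfVec_mem _ _,
    fun h => hv0 (polyOfVec_injective a (h.trans (map_zero _).symm)), fun i hi => ?_⟩
  rw [momentFunctional_X_pow_mul_polyOfVec]
  have : ∑ l : Fin a, f (l + i) * v l = 0 := congrFun (LinearMap.mem_ker.1 hv) ⟨i, hi⟩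
  simpa [add_comm] using this

/-- Trading a column for a row of each block does not increase a rank below the sizes of both
blocks. -/
lemma le_rank_seqStack_succ {a b k : ℕ} {f g : ℕ → K}
    (ha : (seqStack a b (k + 1) f g).rank < a) (hb : (seqStack a b (k + 1) f g).rank < b) :
    (seqStack (a + 1) (b + 1) k f g).rank ≤ (seqStack a b (k + 1) f g).rank := by
  have h1 := finrank_leftKer (a + 1) (b + 1) k f g
  have h2 := finrank_leftKer a b (k + 1) f g
  have hf : (seqHankel a (k + 1) f).rank < a :=
    ((seqStack a b (k + 1) f g).rank_submatrix_le Sum.inl id).trans_lt ha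
  have hg : (seqHankel b (k + 1) g).rank < b :=
    ((seqStack a b (k + 1) f g).rank_submatrix_le Sum.inr id).trans_lt hb
  set V := leftKer a b (k + 1) f g with hV
  have hle : V ≤ leftKer (a + 1) (b + 1) k f g := by
    intro r hr
    obtain ⟨hr1, hr2, hr3⟩ := mem_leftKer.1 hr
    exact mem_leftKer.2 ⟨degreeLT_mono (Nat.le_succ a) hr1, degreeLT_mono (Nat.le_succ b) hr2,
      fun i hi => hr3 i (by omega)⟩
  have hX : ∀ r ∈ V, (X * r.1, X * r.2) ∈ leftKer (a + 1) (b + 1) k f g := by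
    intro r hr
    obtain ⟨hr1, hr2, hr3⟩ := mem_leftKer.1 hr
    refine mem_leftKer.2 ⟨X_mul_mem_degreeLT hr1, X_mul_mem_degreeLT hr2, fun i hi => ?_⟩
    rw [← mul_assoc, ← mul_assoc, ← pow_succ]
    exact hr3 _ (by omega)
  obtain ⟨u, hu, hu0, hfu⟩ := exists_leftKer_of_rank_lt hf
  obtain ⟨v, hv, hv0, hgv⟩ := exists_leftKer_of_rank_lt hg
  have huV : (u, (0 : K[X])) ∈ V :=
    mem_leftKer.2 ⟨hu, Submodule.zero_mem _, fun i hi => by simpa using hfu i hi⟩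
  have hvV : ((0 : K[X]), v) ∈ V :=
    mem_leftKer.2 ⟨Submodule.zero_mem _, hv, fun i hi => by simpa using hgv i hi⟩
  obtain ⟨p, hp, hXp⟩ := exists_X_mul_notMem (n := a) (P := V.map (LinearMap.fst K _ _))
    (by rintro _ ⟨r, hr, rfl⟩; exact (mem_leftKer.1 hr).1) ⟨_, huV, rfl⟩ hu0
  obtain ⟨q, hq, hXq⟩ := exists_X_mul_notMem (n := b) (P := V.comap (LinearMap.inr K _ _))
    (fun r hr => (mem_leftKer.1 hr).2.1) hvV hv0
  obtain ⟨⟨p, w⟩, hpw, rfl⟩ := hp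
  have hXq' : ((0 : K[X]), X * q) ∈ leftKer (a + 1) (b + 1) k f g := by simpa using hX _ hq
  have hlt1 : V < V ⊔ K ∙ ((0 : K[X]), X * q) := by
    refine lt_of_le_of_ne le_sup_left fun he => hXq ?_
    have : ((0 : K[X]), X * q) ∈ V := by
      rw [he]
      exact Submodule.mem_sup_right (Submodule.mem_span_singleton_self _)
    exact this
  have hlt2 : V ⊔ K ∙ ((0 : K[X]), X * q) < leftKer (a + 1) (b + 1) k f g := by
    refine lt_of_le_of_ne (sup_le hle ((Submodule.span_singleton_le_iff_mem _ _).2 hXq'))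
      fun he => hXp ?_
    have := hX _ hpw
    rw [← he] at this
    obtain ⟨y, hy, z, hz, hyz⟩ := Submodule.mem_sup.1 this
    obtain ⟨c, rfl⟩ := Submodule.mem_span_singleton.1 hz
    refine ⟨y, hy, ?_⟩
    simpa using congrArg Prod.fst hyz
  have := Submodule.finrank_lt_finrank_of_lt hlt1
  have := Submodule.finrank_lt_finrank_of_lt hlt2
  omega

lemma rank_seqStack_le_of_lt {a b k t : ℕ} {f g : ℕ → K} (hab : a ≤ b)
    (h : (seqStack a b (k + t) f g).rank < a) :
    (seqStack (a + t) (b + t) k f g).rank ≤ (seqStack a b (k + t) f g).rank := by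
  induction t generalizing k with
  | zero => exact le_rfl
  | succ t ih =>
    have e : k + (t + 1) = k + 1 + t := by omega
    rw [e] at h ⊢
    have h1 := ih h
    exact (le_rank_seqStack_succ (a := a + t) (b := b + t) (by omega) (by omega)).trans h1

lemma rank_seqStack_le_of_lt_width {a b k t : ℕ} {f g : ℕ → K}
    (h : (seqStack (a + t) (b + t) k f g).rank < k) :
    (seqStack a b (k + t) f g).rank ≤ (seqStack (a + t) (b + t) k f g).rank := by
  induction t generalizing a b with
  | zero => exact le_rfl
  | succ t ih =>
    have ea : a + (t + 1) = a + 1 + t := by omega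
    have eb : b + (t + 1) = b + 1 + t := by omega
    rw [ea, eb] at h ⊢
    have h1 := ih h
    exact (rank_seqStack_succ_le (k := k + t) (by omega)).trans h1

/-- Extension of a finite sequence by zero. -/
def extendZero {n : ℕ} (α : Fin n → K) (i : ℕ) : K :=
  if h : i < n then α ⟨i, h⟩ else 0

/-- The Hankel matrix of `α` applied to `v` is this matrix applied to `α`. -/
noncomputable def convMatrix (a N : ℕ) {k : ℕ} (v : Fin k → K) : Matrix (Fin a) (Fin N) K :=
  Matrix.of fun i n => (X ^ (i : ℕ) * polyOfVec K k v).coeff n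

lemma seqHankel_extendZero_mulVec {a k N : ℕ} (hN : a + k = N + 1) (α : Fin N → K)
    (v : Fin k → K) :
    seqHankel a k (extendZero α) *ᵥ v = convMatrix a N v *ᵥ α := by
  ext i
  have hmem : X ^ (i : ℕ) * polyOfVec K k v ∈ degreeLT K N := by
    have h := mem_degreeLT.1 (polyOfVec_mem k v)
    rw [mem_degreeLT]
    by_cases h0 : polyOfVec K k v = 0
    · simp [h0]
    · rw [degree_mul, degree_X_pow, degree_eq_natDegree h0] at *
      norm_cast at *
      omega
  obtain ⟨w, hw⟩ := exists_polyOfVec hmem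
  have hcoeff : ∀ n : Fin N, (X ^ (i : ℕ) * polyOfVec K k v).coeff n = w n := by
    intro n
    rw [← hw, polyOfVec_eq_sum, finsetSum_coeff]
    simp [coeff_monomial, Fin.val_inj]
  have h1 := momentFunctional_X_pow_mul_polyOfVec (extendZero α) k i v
  have h2 := momentFunctional_X_pow_mul_polyOfVec (extendZero α) N 0 w
  rw [pow_zero, one_mul, hw, h1] at h2
  refine h2.trans ?_
  simp [convMatrix, Matrix.mulVec, dotProduct, hcoeff, extendZero, mul_comm]

lemma rank_convMatrix {a k N : ℕ} (hN : a + k = N + 1) {v : Fin k → K} (hv : v ≠ 0) :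
    (convMatrix a N v).rank = a := by
  have hinj : Function.Injective fun c => c ᵥ* convMatrix a N v := by
    change Function.Injective (convMatrix a N v).vecMulLinear
    rw [injective_iff_map_eq_zero]
    intro c hc
    have hc0 : polyOfVec K a c * polyOfVec K k v = 0 := by
      ext n
      by_cases hn : n < N
      · have := congrFun hc ⟨n, hn⟩
        simpa [polyOfVec_eq_sum a, Finset.sum_mul, convMatrix, Matrix.vecMul, dotProduct,
          ← C_mul_X_pow_eq_monomial, mul_assoc] using this
      · rw [coeff_zero]
        apply coeff_eq_zero_of_degree_lt
        have h1 := mem_degreeLT.1 (polyOfVec_mem a c)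
        have h2 := mem_degreeLT.1 (polyOfVec_mem k v)
        by_cases h10 : polyOfVec K a c = 0
        · simp [h10]
        by_cases h20 : polyOfVec K k v = 0
        · simp [h20]
        rw [degree_mul]
        rw [degree_eq_natDegree h10, degree_eq_natDegree h20] at *
        norm_cast at *
        omega
    rcases mul_eq_zero.1 hc0 with h | h
    · exact polyOfVec_injective a (h.trans (map_zero _).symm)
    · exact absurd (polyOfVec_injective k (h.trans (map_zero _).symm)) hv
  simpa using (Matrix.vecMul_injective_iff.1 hinj).rank_matrix

end HankelRank

section Counting

open Module

lemma card_mulVec_eq_zero {m n : Type*} [Fintype m] [Fintype n] [DecidableEq n]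
    [DecidableEq m] (M : Matrix m n (ZMod 2)) :
    (Finset.univ.filter fun v => M *ᵥ v = 0).card = 2 ^ (Fintype.card n - M.rank) := by
  have h := finrank_ker_mulVecLin_add_rank M
  have hc := Module.natCard_eq_pow_finrank (K := ZMod 2) (V := LinearMap.ker M.mulVecLin)
  rw [Nat.card_zmod] at hc
  rw [← h, Nat.add_sub_cancel, ← hc, ← Fintype.card_subtype, ← Nat.card_eq_fintype_card]
  exact Nat.card_congr (Equiv.subtypeEquivRight fun v => by simp)

lemma card_mulVec_eq_zero_ne_zero {m n : Type*} [Fintype m] [Fintype n] [DecidableEq n]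
    [DecidableEq m] (M : Matrix m n (ZMod 2)) :
    ((Finset.univ.erase 0).filter fun v => M *ᵥ v = 0).card + 1 =
      2 ^ (Fintype.card n - M.rank) := by
  rw [← card_mulVec_eq_zero, Finset.filter_erase]
  exact Finset.card_erase_add_one (by simp)

/-- The pairs killing a fixed nonzero vector. -/
lemma card_pairs_seqStack_mulVec_eq_zero {a b k M N : ℕ} (hM : a + k = M + 1)
    (hN : b + k = N + 1) {v : Fin k → ZMod 2} (hv : v ≠ 0) :
    ((Finset.univ : Finset ((Fin M → ZMod 2) × (Fin N → ZMod 2))).filter fun p =>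
      seqStack a b k (extendZero p.1) (extendZero p.2) *ᵥ v = 0).card = 4 ^ (k - 1) := by
  have h : ((Finset.univ : Finset ((Fin M → ZMod 2) × (Fin N → ZMod 2))).filter fun p =>
      seqStack a b k (extendZero p.1) (extendZero p.2) *ᵥ v = 0) =
      (Finset.univ.filter fun α => convMatrix a M v *ᵥ α = 0) ×ˢ
        (Finset.univ.filter fun β => convMatrix b N v *ᵥ β = 0) := by
    ext p
    simp [seqStack, fromRows_mulVec, seqHankel_extendZero_mulVec hM,
      seqHankel_extendZero_mulVec hN, funext_iff]
  rw [h, Finset.card_product, card_mulVec_eq_zero, card_mulVec_eq_zero, rank_convMatrix hM hv,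
    rank_convMatrix hN hv, Fintype.card_fin, Fintype.card_fin,
    show M - a = k - 1 by omega, show N - b = k - 1 by omega, ← mul_pow,
    show 2 * 2 = 4 from rfl]

lemma sum_pairs_two_pow_sub_rank {a b k M N : ℕ} (hM : a + k = M + 1) (hN : b + k = N + 1) :
    ∑ p : (Fin M → ZMod 2) × (Fin N → ZMod 2),
      ((2 : ℤ) ^ (k - (seqStack a b k (extendZero p.1) (extendZero p.2)).rank) - 1) =
      (2 ^ k - 1) * 4 ^ (k - 1) := by
  have h := Finset.sum_card_bipartiteAbove_eq_sum_card_bipartiteBelow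
    (fun (p : (Fin M → ZMod 2) × (Fin N → ZMod 2)) (v : Fin k → ZMod 2) =>
      seqStack a b k (extendZero p.1) (extendZero p.2) *ᵥ v = 0)
    (s := Finset.univ) (t := Finset.univ.erase 0)
  simp only [Finset.bipartiteAbove, Finset.bipartiteBelow] at h
  rw [Finset.sum_congr rfl fun v hv => card_pairs_seqStack_mulVec_eq_zero hM hN
    (Finset.ne_of_mem_erase hv), Finset.sum_const, Finset.card_erase_of_mem (Finset.mem_univ _),
    Finset.card_univ, Fintype.card_fun, ZMod.card, Fintype.card_fin, smul_eq_mul] at h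
  have h' := congrArg (Nat.cast : ℕ → ℤ) h
  rw [Nat.cast_sum, Nat.cast_mul, Nat.cast_sub Nat.one_le_two_pow] at h'
  push_cast at h'
  rw [← h']
  refine Finset.sum_congr rfl fun p _ => ?_
  have := card_mulVec_eq_zero_ne_zero (seqStack a b k (extendZero p.1) (extendZero p.2))
  rw [Fintype.card_fin] at this
  rw [sub_eq_iff_eq_add]
  exact_mod_cast this.symm

lemma hankel_eq_seqHankel (a k : ℕ) (α : Fin (a + k - 1) → ZMod 2) :
    hankel a k α = seqHankel a k (extendZero α) := by
  ext i j
  have : (i : ℕ) + j < a + k - 1 := by omega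
  simp [hankel, seqHankel, extendZero, this]

lemma sum_Gamma_eq_card (a b k s : ℕ) :
    ∑ j ∈ Finset.range s, Gamma a b k j =
      (Finset.univ.filter fun p : (Fin (a + k - 1) → ZMod 2) × (Fin (b + k - 1) → ZMod 2) =>
        (seqStack a b k (extendZero p.1) (extendZero p.2)).rank < s).card := by
  rw [Finset.card_eq_sum_card_fiberwise (t := Finset.range s)
    (f := fun p => (seqStack a b k (extendZero p.1) (extendZero p.2)).rank)
    (fun p hp => by simpa using hp)]
  refine Finset.sum_congr rfl fun j hj => ?_
  rw [Gamma, Nat.card_eq_fintype_card, Fintype.card_subtype, Finset.filter_filter]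
  congr 1
  ext p
  have := Finset.mem_range.1 hj
  rw [Finset.mem_filter, Finset.mem_filter, hankel_eq_seqHankel, hankel_eq_seqHankel]
  change _ ∧ (seqStack a b k _ _).rank = j ↔ _
  grind

/-- The number of nonzero kernel vectors with `s` columns minus twice that number with `s - 1`
columns detects rank less than `s`. -/
lemma indicator_rank_lt {K : Type*} [Field K] {s m t : ℕ} (hs : 1 ≤ s) (f g : ℕ → K) :
    (if (seqStack s (s + m) (s + t) f g).rank < s then (1 : ℤ) else 0) =
      (2 ^ (s - (seqStack (s + t) (s + m + t) s f g).rank) - 1) -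
      2 * (2 ^ (s - 1 - (seqStack (s + t + 1) (s + m + t + 1) (s - 1) f g).rank) - 1) := by
  obtain ⟨n, rfl⟩ : ∃ n, s = n + 1 := ⟨s - 1, by omega⟩
  rw [Nat.add_sub_cancel]
  have hw0 := (seqStack (n + 1 + t) (n + 1 + m + t) (n + 1) f g).rank_le_card_width
  have hw1 := (seqStack (n + 1 + t + 1) (n + 1 + m + t + 1) n f g).rank_le_card_width
  rw [Fintype.card_fin] at hw0 hw1
  have hup := rank_seqStack_le_of_lt (a := n + 1) (b := n + 1 + m) (k := n + 1) (t := t)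
    (f := f) (g := g) (by omega)
  have hdown := rank_seqStack_le_of_lt_width (a := n + 1) (b := n + 1 + m) (k := n + 1) (t := t)
    (f := f) (g := g)
  have hup1 := le_rank_seqStack_succ (a := n + 1 + t) (b := n + 1 + m + t) (k := n)
    (f := f) (g := g)
  have hdown1 := rank_seqStack_succ_le (a := n + 1 + t) (b := n + 1 + m + t) (k := n)
    (f := f) (g := g)
  generalize (seqStack (n + 1 + t) (n + 1 + m + t) (n + 1) f g).rank = r at *
  generalize (seqStack (n + 1 + t + 1) (n + 1 + m + t + 1) n f g).rank = r' at *
  split_ifs with h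
  · have h1 := hup h
    have h2 := hup1 (by omega) (by omega)
    have : r = r' := by
      by_contra hne
      have := hdown1 (by omega)
      omega
    rw [← this, show n + 1 - r = n - r + 1 by omega, pow_succ]
    ring
  · have hr : r = n + 1 := by
      by_contra hne
      have := hdown (by omega)
      omega
    have hr' : r' = n := by
      by_contra hne
      have := hdown1 (by omega)
      omega
    simp [hr, hr']

end Counting

theorem sum_Gamma_rank_lt_s (s m k : ℕ) (hs : 2 ≤ s) (hk : s ≤ k) :
    (∑ j ∈ Finset.range s, (Gamma s (s + m) k j : ℤ)) = 3 * 2 ^ (3 * s - 4) - 2 ^ (2 * s - 3) := by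
  obtain ⟨t, rfl⟩ := Nat.exists_eq_add_of_le hk
  rw [← Nat.cast_sum, sum_Gamma_eq_card, Finset.card_filter, Nat.cast_sum]
  push_cast
  simp only [indicator_rank_lt (m := m) (t := t) (by omega : 1 ≤ s)]
  rw [Finset.sum_sub_distrib, ← Finset.mul_sum, sum_pairs_two_pow_sub_rank (by omega) (by omega),
    sum_pairs_two_pow_sub_rank (by omega) (by omega)]
  obtain ⟨n, rfl⟩ := Nat.exists_eq_add_of_le hs
  have h4 (i : ℕ) : (4 : ℤ) ^ i = 2 ^ (2 * i) := by rw [pow_mul]; norm_num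
  rw [show 2 + n - 1 = n + 1 by omega, show 3 * (2 + n) - 4 = 3 * n + 2 by omega,
    show 2 * (2 + n) - 3 = 2 * n + 1 by omega, Nat.add_sub_cancel, h4, h4]
  ring
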